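/- Let φ : R → S be a homomorphism of rings (not necessarily commutative). Then the functor D(φ) : D(S) → D(R) between unbounded derived categories induced by restriction of scalars is fully faithful if and only if for every left S-module M the canonical map η_M : M → Hom_R(S, M), m ↦ (s ↦ s • m), is bijective and Ext^i_R(S, M) = 0 for all i ≥ 1. -/

import Mathlib

/-!
Homological epimorphisms of rings (Geigle–Lenzing).
`φ : R →+* S`; every `S`-module is an `R`-module by restriction of scalars.
-/

universe w u

open CategoryTheory Limits DerivedCategory

noncomputable section

namespace RingHomEpi

variable {R S : Type u} [Ring R] [Ring S] (φ : R →+* S)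

instance : (ModuleCat.restrictScalars.{u} φ).Additive where
  map_add := rfl

/-- `S` regarded as an `R`-module via `φ`. -/
abbrev SasR : ModuleCat.{u} R := (ModuleCat.restrictScalars φ).obj (ModuleCat.of S S)

/-- The canonical map `η_M : M → Hom_R(S, M)`, `m ↦ (s ↦ s • m)`. -/
def etaMap (M : ModuleCat.{u} S) :
    M → (SasR φ →ₗ[R] (ModuleCat.restrictScalars φ).obj M) := fun m =>
  { toFun := fun s => (show S from s) • (show M from m)
    map_add' := fun s t => add_smul (show S from s) (show S from t) (show M from m)
    map_smul' := fun r s => by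
      show (φ r • (show S from s)) • (show M from m) =
        φ r • ((show S from s) • (show M from m))
      exact smul_assoc (φ r) (show S from s) (show M from m) }

/-- Restriction of scalars is compatible with the forgetful functors to abelian groups. -/
def restrictScalarsCompForget₂Iso :
    ModuleCat.restrictScalars.{u} φ ⋙ forget₂ (ModuleCat.{u} R) AddCommGrpCat ≅
      forget₂ (ModuleCat.{u} S) AddCommGrpCat :=
  NatIso.ofComponents (fun _ => Iso.refl _) (fun _ => rfl)

instance : PreservesFiniteLimits (ModuleCat.restrictScalars.{u} φ) := by
  have : PreservesFiniteLimits
      (ModuleCat.restrictScalars.{u} φ ⋙ forget₂ (ModuleCat.{u} R) AddCommGrpCat) :=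
    preservesFiniteLimits_of_natIso (restrictScalarsCompForget₂Iso φ).symm
  exact preservesFiniteLimits_of_reflects_of_preserves _
    (forget₂ (ModuleCat.{u} R) AddCommGrpCat)

instance : PreservesFiniteColimits (ModuleCat.restrictScalars.{u} φ) := by
  have : PreservesFiniteColimits
      (ModuleCat.restrictScalars.{u} φ ⋙ forget₂ (ModuleCat.{u} R) AddCommGrpCat) :=
    preservesFiniteColimits_of_natIso (restrictScalarsCompForget₂Iso φ).symm
  exact preservesFiniteColimits_of_reflects_of_preserves _
    (forget₂ (ModuleCat.{u} R) AddCommGrpCat)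

attribute [local instance] CategoryTheory.hasExt_of_hasDerivedCategory

variable [HasDerivedCategory.{w} (ModuleCat.{u} R)]
  [HasDerivedCategory.{w} (ModuleCat.{u} S)]

/-- The functor `D(φ) : D(S) → D(R)` induced by restriction of scalars along `φ`. -/
abbrev Dphi : DerivedCategory (ModuleCat.{u} S) ⥤ DerivedCategory (ModuleCat.{u} R) :=
  (ModuleCat.restrictScalars.{u} φ).mapDerivedCategory

/-- `D(φ)` commutes with the single complex functors. -/
def singleObjIso (M : ModuleCat.{u} S) :
    (Dphi φ).obj ((DerivedCategory.singleFunctor (ModuleCat.{u} S) 0).obj M) ≅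
      (DerivedCategory.singleFunctor (ModuleCat.{u} R) 0).obj
        ((ModuleCat.restrictScalars φ).obj M) :=
  (Dphi φ).mapIso
    (((SingleFunctors.evaluation _ _ 0).mapIso
      (DerivedCategory.singleFunctorsPostcompQIso (ModuleCat.{u} S))).app M)
  ≪≫ ((ModuleCat.restrictScalars.{u} φ).mapDerivedCategoryFactors.app _)
  ≪≫ DerivedCategory.Q.mapIso
      ((HomologicalComplex.singleMapHomologicalComplex
        (ModuleCat.restrictScalars.{u} φ) (ComplexShape.up ℤ) 0).app M)
  ≪≫ (((SingleFunctors.evaluation _ _ 0).mapIso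
      (DerivedCategory.singleFunctorsPostcompQIso (ModuleCat.{u} R))).symm.app _)

/-- The natural comparison map `Ext^n_S(M, M') → Ext^n_R(M, M')` induced by
restriction of scalars along `φ`. -/
def extMap {M M' : ModuleCat.{u} S} {n : ℕ} (e : Abelian.Ext.{w} M M' n) :
    Abelian.Ext.{w} ((ModuleCat.restrictScalars φ).obj M)
      ((ModuleCat.restrictScalars φ).obj M') n :=
  Abelian.Ext.homEquiv.symm
    ((singleObjIso φ M).inv ≫ (Dphi φ).map e.hom ≫
      ((Dphi φ).commShiftIso (n : ℤ)).hom.app _ ≫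
      (shiftFunctor (DerivedCategory (ModuleCat.{u} R)) (n : ℤ)).map
        (singleObjIso φ M').hom)


section
universe v
open CategoryTheory Limits
noncomputable section
namespace HEpiAux
open CochainComplex HomComplex Preadditive

section NullHomotopy
variable {C : Type u} [Category.{v} C] [Abelian C]

lemma exists_lift_of_class_zero {L : CochainComplex C ℤ} {P : C} [Projective P] (i n j : ℤ)
    (hi : i + 1 = n) (hj : n + 1 = j)
    (r : P ⟶ L.X n) (hr : r ≫ L.d n j = 0)
    (h0 : L.liftCycles r j (by simp [← hj]) hr ≫ L.homologyπ n = 0) :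
    ∃ k : P ⟶ L.X i, k ≫ L.d i n = r := by
  have hex : (ShortComplex.mk (L.toCycles i n) (L.homologyπ n) (by simp)).Exact :=
    ShortComplex.exact_of_g_is_cokernel _ (L.homologyIsCokernel i n (by simp [← hi]))
  refine ⟨hex.liftFromProjective _ h0, ?_⟩
  have := hex.liftFromProjective_comp _ h0
  have h2 := congrArg (fun z => z ≫ L.iCycles n) this
  simpa using h2

/-- the induction step -/
lemma nullHomotopy_aux {P L : CochainComplex C ℤ} (f : P ⟶ L) [∀ n, Projective (P.X n)]
    (n m : ℤ) (hnm : m + 1 = n)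
    (hE : ∀ g : P.X m ⟶ L.homology m, P.d (m - 1) m ≫ g = 0 → ∃ g', P.d m n ≫ g' = g)
    (h : P.X (n + 1) ⟶ L.X n)
    (h1 : (f.f n - P.d n (n + 1) ≫ h) ≫ L.d n (n + 1) = 0)
    (h2 : L.liftCycles (f.f n - P.d n (n + 1) ≫ h) (n + 1) (by simp) h1 ≫ L.homologyπ n = 0) :
    ∃ h' : P.X n ⟶ L.X m, f.f n = P.d n (n + 1) ≫ h + h' ≫ L.d m n ∧
      ∃ h1' : (f.f m - P.d m n ≫ h') ≫ L.d m n = 0,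
      L.liftCycles (f.f m - P.d m n ≫ h') n (by simp [hnm]) h1' ≫ L.homologyπ m = 0 := by
  obtain ⟨k, hk⟩ := exists_lift_of_class_zero m n (n + 1) hnm rfl _ h1 h2
  have hk' : (f.f m - P.d m n ≫ k) ≫ L.d m n = 0 := by
    simp [hk]
  obtain ⟨g, hg⟩ := hE (L.liftCycles (f.f m - P.d m n ≫ k) n (by simp [hnm]) hk' ≫
    L.homologyπ m) (by
      have : P.d (m - 1) m ≫ L.liftCycles (f.f m - P.d m n ≫ k) n (by simp [hnm]) hk' =
        f.f (m - 1) ≫ L.toCycles (m - 1) m := by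
        rw [← cancel_mono (L.iCycles m)]
        simp
      rw [reassoc_of% this]
      simp)
  refine ⟨k + Projective.factorThru g (L.homologyπ m) ≫ L.iCycles m, ?_, ?_, ?_⟩
  · simp [hk]
  · simp [hk]
  · have : L.liftCycles (f.f m - P.d m n ≫ (k + Projective.factorThru g (L.homologyπ m) ≫
        L.iCycles m)) n (by simp [hnm]) (by simp [hk]) =
        L.liftCycles (f.f m - P.d m n ≫ k) n (by simp [hnm]) hk' -
          P.d m n ≫ Projective.factorThru g (L.homologyπ m) := by
      rw [← cancel_mono (L.iCycles m)]
      simp [sub_sub]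
    rw [this]
    simp [← hg]

/-- Maps from a bounded above complex of projectives are null-homotopic when suitable
cocycles are coboundaries. -/
lemma nullHomotopy {P L : CochainComplex C ℤ} (f : P ⟶ L) [∀ n, Projective (P.X n)]
    [P.IsStrictlyLE 0] [L.IsStrictlyLE (-1)]
    (hE : ∀ (n : ℤ), n ≤ -1 → ∀ g : P.X n ⟶ L.homology n, P.d (n - 1) n ≫ g = 0 →
      ∃ g', P.d n (n + 1) ≫ g' = g) :
    Nonempty (Homotopy f 0) := by
  -- approximate solutions
  let good (α : Cochain P L (-1)) (n : ℤ) : Prop :=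
    ∃ h1 : (f.f n - P.d n (n + 1) ≫ α.v (n + 1) n (by lia)) ≫ L.d n (n + 1) = 0,
      L.liftCycles (f.f n - P.d n (n + 1) ≫ α.v (n + 1) n (by lia)) (n + 1) (by simp) h1 ≫
        L.homologyπ n = 0
  have step (α : Cochain P L (-1)) (n : ℤ) (hn : n ≤ 0) (hα : good α n) :
      ∃ β : Cochain P L (-1), good β (n - 1) ∧
        f.f n = P.d n (n + 1) ≫ α.v (n + 1) n (by lia) + β.v n (n - 1) (by lia) ≫ L.d _ n := by
    obtain ⟨h1, h2⟩ := hα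
    have hE' : ∀ m, n - 1 + 1 = m → ∀ g : P.X (n - 1) ⟶ L.homology (n - 1),
        P.d (n - 1 - 1) (n - 1) ≫ g = 0 → ∃ g', P.d (n - 1) m ≫ g' = g := by
      rintro _ rfl
      exact hE (n - 1) (by lia)
    obtain ⟨h', e1, e2, e3⟩ := nullHomotopy_aux f n (n - 1) (by lia) (hE' n (by lia)) _ h1 h2
    obtain ⟨β, rfl⟩ : ∃ β : Cochain P L (-1), β.v n (n - 1) (by lia) = h' :=
      ⟨Cochain.single h' (-1), by simp⟩
    refine ⟨β, ?_, e1⟩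
    have key : ∀ (m : ℤ) (hm : n - 1 + 1 = m) (e2 : (f.f (n - 1) - P.d (n - 1) m ≫
        β.v m (n - 1) (by lia)) ≫ L.d (n - 1) m = 0)
        (e3 : L.liftCycles (f.f (n - 1) - P.d (n - 1) m ≫ β.v m (n - 1) (by lia)) m
          (by simp [hm]) e2 ≫ L.homologyπ (n - 1) = 0), good β (n - 1) := by
      rintro _ rfl e2 e3
      exact ⟨e2, e3⟩
    exact key n (by lia) e2 e3
  have hz : good 0 0 := by
    have hL := L.isZero_of_isStrictlyLE (-1) 0 (by lia)
    refine ⟨by rw [hL.eq_of_tgt (f.f 0 - _) 0, zero_comp], ?_⟩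
    apply IsZero.eq_of_tgt
    rw [← L.exactAt_iff_isZero_homology]
    exact HomologicalComplex.ExactAt.of_isZero hL
  choose! nx hn1 hn2 using step
  let s (k : ℕ) : Cochain P L (-1) := Nat.rec 0 (fun k α => nx α (-k)) k
  have hs (k : ℕ) : good (s k) (-k) := by
    induction k with
    | zero =>
      rw [show -((0 : ℕ) : ℤ) = 0 by simp]
      exact hz
    | succ k hk =>
      have := hn1 (s k) (-k) (by lia) hk
      rwa [show -(k : ℤ) - 1 = -((k + 1 : ℕ) : ℤ) by push_cast; ring] at this
  have hs2 (k : ℕ) := hn2 (s k) (-k) (by lia) (hs k)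
  let β : Cochain P L (-1) := Cochain.mk (fun p q hpq => (s ((-p).toNat + 1)).v p q hpq)
  refine ⟨(Cochain.equivHomotopy f 0).symm ⟨β, ?_⟩⟩
  rw [Cochain.ofHom_zero, add_zero]
  ext n
  by_cases hn : 0 < n
  · exact (P.isZero_of_isStrictlyLE 0 _ (by lia)).eq_of_src _ _
  obtain ⟨k, rfl⟩ : ∃ k : ℕ, n = -k := ⟨(-n).toNat, by lia⟩
  rw [δ_v (-1) 0 (neg_add_cancel 1) _ _ _ (by lia) (-(k : ℤ) - 1) (-(k : ℤ) + 1) rfl (by lia)]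
  simp only [Cochain.ofHom_v, Int.negOnePow_zero, one_smul]
  rw [hs2 k, add_comm]
  have e1 : β.v (-k) (-k - 1) (by lia) = (nx (s k) (-k)).v (-k) (-k - 1) (by lia) := by
    simp [β, s]
  have e2 : β.v (-k + 1) (-k) (by lia) = (s k).v (-k + 1) (-k) (by lia) := by
    by_cases hk : k = 0
    · exact (P.isZero_of_isStrictlyLE 0 _ (by lia)).eq_of_src _ _
    · dsimp only [β, Cochain.mk_v]
      rw [show (-(-(k : ℤ) + 1)).toNat + 1 = k by lia]
  rw [e1, e2]
end NullHomotopy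
end HEpiAux
end
end

section
universe w' v
open CategoryTheory Limits
noncomputable section
namespace HEpiAux
open CochainComplex HomComplex Preadditive

section Vanish
variable {C : Type u} [Category.{v} C] [Abelian C] [HasDerivedCategory.{w} C] [HasExt.{w'} C]
  [EnoughProjectives C]

lemma factor_of_ext {X : C} (R : ProjectiveResolution X) (Y : C) (n : ℤ) (hn : n ≤ -1)
    (h : Subsingleton (Abelian.Ext.{w'} X Y (-n).toNat))
    (g : R.cochainComplex.X n ⟶ Y) (hg : R.cochainComplex.d (n - 1) n ≫ g = 0) :
    ∃ g', R.cochainComplex.d n (n + 1) ≫ g' = g := by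
  obtain ⟨k, rfl⟩ : ∃ k : ℕ, n = -((k + 1 : ℕ) : ℤ) := ⟨(-n).toNat - 1, by lia⟩
  have hk : (-(-((k + 1 : ℕ) : ℤ))).toNat = k + 1 := by simp only [neg_neg, Int.toNat_natCast]
  rw [hk] at h
  have e1 := R.cochainComplex_d (-((k + 1 : ℕ) : ℤ)) (-((k + 1 : ℕ) : ℤ) + 1) (k + 1) k
    (by lia) (by lia)
  have e2 := R.cochainComplex_d (-((k + 1 : ℕ) : ℤ) - 1) (-((k + 1 : ℕ) : ℤ)) (k + 2) (k + 1)
    (by lia) (by lia)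
  rw [e2] at hg
  let g₀ := (R.cochainComplexXIso (-((k + 1 : ℕ) : ℤ)) (k + 1) (by lia)).inv ≫ g
  have hg₀ : R.complex.d (k + 2) (k + 1) ≫ g₀ = 0 := by
    rw [← cancel_epi (R.cochainComplexXIso (-((k + 1 : ℕ) : ℤ) - 1) (k + 2) (by lia)).hom]
    simpa [g₀] using hg
  obtain ⟨g', hg'⟩ := (R.extMk_eq_zero_iff g₀ (k + 2) rfl hg₀ k rfl).1 (Subsingleton.elim _ _)
  refine ⟨(R.cochainComplexXIso _ k (by lia)).hom ≫ g', ?_⟩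
  rw [e1]
  simp [hg', g₀]

lemma hom_single_eq_zero (X : C) (L : CochainComplex C ℤ) [L.IsStrictlyLE (-1)]
    (h : ∀ n : ℤ, n ≤ -1 → Subsingleton (Abelian.Ext.{w'} X (L.homology n) (-n).toNat))
    (f : (DerivedCategory.singleFunctor C 0).obj X ⟶ DerivedCategory.Q.obj L) : f = 0 := by
  let R := projectiveResolution X
  let e : DerivedCategory.Q.obj R.cochainComplex ≅ (DerivedCategory.singleFunctor C 0).obj X :=
    asIso (DerivedCategory.Q.map R.π') ≪≫ ((DerivedCategory.singleFunctorIsoCompQ C 0).app X).symm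
  rw [← cancel_epi e.hom, comp_zero]
  obtain ⟨g, hg⟩ := (IsKProjective.Qh_map_bijective R.cochainComplex
    ((HomotopyCategory.quotient _ _).obj L)).surjective (e.hom ≫ f)
  obtain ⟨g, rfl⟩ := (HomotopyCategory.quotient _ _).map_surjective g
  refine hg.symm.trans ?_
  obtain ⟨H⟩ := nullHomotopy g (fun n hn g hg => factor_of_ext R _ n hn (h n hn) g hg)
  rw [HomotopyCategory.eq_of_homotopy _ _ H]
  rw [Functor.map_zero, Functor.map_zero]
  rfl
end Vanish
end HEpiAux
end
end

section
universe w' v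
open CategoryTheory Limits
noncomputable section
namespace HEpiAux

section HomologyColim
variable {C : Type u} [Category.{v} C] [Abelian C] {J : Type w} [SmallCategory J]
  [HasColimitsOfShape J C] [HasExactColimitsOfShape J C]

/-- inclusion as natural transformation -/
def evToColim (j : J) : (evaluation J C).obj j ⟶ colim where
  app F := colimit.ι F j

instance : (colim : (J ⥤ C) ⥤ C).PreservesZeroMorphisms := by
  infer_instance

instance : PreservesFiniteLimits (colim : (J ⥤ C) ⥤ C) := by infer_instance
instance : PreservesFiniteColimits (colim : (J ⥤ C) ⥤ C) := by infer_instance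
instance : (colim : (J ⥤ C) ⥤ C).PreservesHomology := by infer_instance
instance (j : J) : ((evaluation J C).obj j).PreservesHomology := by infer_instance

/-- cocone -/
def scCocone (T : ShortComplex (J ⥤ C)) :
    Cocone ((ShortComplex.FunctorEquivalence.functor J C).obj T) where
  pt := T.map colim
  ι :=
    { app j := T.mapNatTrans (evToColim j)
      naturality i j f := by
        refine (ShortComplex.hom_ext _ _ ?_ ?_ ?_)
        · exact (colimit.w T.X₁ f).trans (Category.comp_id _).symm
        · exact (colimit.w T.X₂ f).trans (Category.comp_id _).symm
        · exact (colimit.w T.X₃ f).trans (Category.comp_id _).symm }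

def isColimitScCocone (T : ShortComplex (J ⥤ C)) : IsColimit (scCocone T) := by
  apply ShortComplex.isColimitOfIsColimitπ
  · exact colimit.isColimit T.X₁
  · exact colimit.isColimit T.X₂
  · exact colimit.isColimit T.X₃

instance preservesColimitsOfShape_sc_homology :
    PreservesColimitsOfShape J (ShortComplex.homologyFunctor C) where
  preservesColimit {D} := by
    let T := (ShortComplex.FunctorEquivalence.inverse J C).obj D
    suffices PreservesColimit ((ShortComplex.FunctorEquivalence.functor J C).obj T)
        (ShortComplex.homologyFunctor C) from by
      have : PreservesColimit ((ShortComplex.FunctorEquivalence.inverse J C ⋙ ShortComplex.FunctorEquivalence.functor J C).obj D) (ShortComplex.homologyFunctor C) := this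
      exact preservesColimit_of_iso_diagram _ ((ShortComplex.FunctorEquivalence.counitIso J C).app D)
    refine preservesColimit_of_preserves_colimit_cocone (isColimitScCocone T) ?_
    let e : (ShortComplex.FunctorEquivalence.functor J C).obj T ⋙ ShortComplex.homologyFunctor C ≅
      T.homology := NatIso.ofComponents (fun j => T.mapHomologyIso ((evaluation J C).obj j))
        (fun {i j} f => by
          have := ShortComplex.homologyMap_mapNatTrans T ((evaluation J C).map f)
          rw [← Category.assoc, Iso.eq_comp_inv] at this
          exact this)
    refine IsColimit.ofIsoColimit ((IsColimit.precomposeHomEquiv e _).symm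
      (colimit.isColimit T.homology)) (Cocone.ext (T.mapHomologyIso colim).symm ?_)
    intro j
    have := ShortComplex.homologyMap_mapNatTrans T (evToColim j)
    exact (Category.assoc _ _ _).trans this.symm

instance preservesColimitsOfShape_homology (n : ℤ) :
    PreservesColimitsOfShape J
      (HomologicalComplex.homologyFunctor C (ComplexShape.up ℤ) n) := by
  have : PreservesColimitsOfShape J
      (HomologicalComplex.shortComplexFunctor C (ComplexShape.up ℤ) n) := by
    constructor
    intro K
    constructor
    intro c hc
    constructor
    apply ShortComplex.isColimitOfIsColimitπ
    · exact isColimitOfPreserves (HomologicalComplex.eval C (ComplexShape.up ℤ) _) hc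
    · exact isColimitOfPreserves (HomologicalComplex.eval C (ComplexShape.up ℤ) _) hc
    · exact isColimitOfPreserves (HomologicalComplex.eval C (ComplexShape.up ℤ) _) hc
  exact preservesColimitsOfShape_of_natIso
    (HomologicalComplex.homologyFunctorIso C (ComplexShape.up ℤ) n).symm
end HomologyColim

end HEpiAux
end
end

section
universe w' v
open CategoryTheory Limits
noncomputable section
namespace HEpiAux
open CochainComplex HomComplex

section QCoprod
variable {C : Type u} [Category.{v} C] [Abelian C] {I : Type w'}
  [HasColimitsOfShape (Discrete I) C] 

lemma nullHomotopic_of_cofan (K : Discrete I ⥤ CochainComplex C ℤ) (c : Cocone K)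
    (hc : IsColimit c) {L : CochainComplex C ℤ} (f : c.pt ⟶ L)
    (h : ∀ i, Nonempty (Homotopy (c.ι.app i ≫ f) 0)) : Nonempty (Homotopy f 0) := by
  have h' (i) : ∃ α : Cochain (K.obj i) L (-1), Cochain.ofHom (c.ι.app i ≫ f) = δ (-1) 0 α := by
    obtain ⟨H⟩ := h i
    obtain ⟨α, hα⟩ := Cochain.equivHomotopy _ _ H
    exact ⟨α, by simpa using hα⟩
  choose α hα using h'
  have hcn (n : ℤ) := isColimitOfPreserves (HomologicalComplex.eval C (ComplexShape.up ℤ) n) hc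
  let β : Cochain c.pt L (-1) := Cochain.mk (fun p q hpq => (hcn p).desc
    (Cocone.mk (L.X q) (Discrete.natTrans (fun i => (α i).v p q hpq))))
  have hβ (i p q hpq) : (c.ι.app i).f p ≫ β.v p q hpq = (α i).v p q hpq :=
    (hcn p).fac (Cocone.mk (L.X q) (Discrete.natTrans (fun i => (α i).v p q hpq))) i
  refine ⟨(Cochain.equivHomotopy f 0).symm ⟨β, ?_⟩⟩
  rw [Cochain.ofHom_zero, add_zero]
  ext n
  refine (hcn n).hom_ext (fun i => ?_)
  have := Cochain.congr_v (hα i) n n (add_zero n)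
  rw [δ_v (-1) 0 (neg_add_cancel 1) _ _ _ _ (n - 1) (n + 1) rfl rfl] at this ⊢
  simp only [Cochain.ofHom_v, HomologicalComplex.comp_f, ← hβ] at this
  change (c.ι.app i).f n ≫ (Cochain.ofHom f).v n n _ = (c.ι.app i).f n ≫ (_ + _)
  rw [Cochain.ofHom_v, this]
  simp

variable [HasDerivedCategory.{w} C] 

lemma exists_qis_of_Q_map_eq_zero {K L : CochainComplex C ℤ} (f : K ⟶ L)
    (hf : DerivedCategory.Q.map f = 0) :
    ∃ (K' : CochainComplex C ℤ) (t : K' ⟶ K), QuasiIso t ∧ Nonempty (Homotopy (t ≫ f) 0) := by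
  have h : DerivedCategory.Qh.map ((HomotopyCategory.quotient _ _).map f) =
      DerivedCategory.Qh.map ((HomotopyCategory.quotient _ _).map (0 : K ⟶ L)) := by
    rw [Functor.map_zero, Functor.map_zero]
    exact hf
  obtain ⟨Z, s, hs, fac⟩ := (MorphismProperty.map_eq_iff_precomp DerivedCategory.Qh
    (HomotopyCategory.quasiIso C (ComplexShape.up ℤ)) _ _).1 h
  obtain ⟨Z, rfl⟩ := HomotopyCategory.quotient_obj_surjective Z
  obtain ⟨s, rfl⟩ := (HomotopyCategory.quotient _ _).map_surjective s
  refine ⟨Z, s, ?_, ⟨HomotopyCategory.homotopyOfEq _ _ ?_⟩⟩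
  · rwa [HomotopyCategory.quotient_map_mem_quasiIso_iff, HomologicalComplex.mem_quasiIso_iff] at hs
  · simpa using fac

variable [HasExactColimitsOfShape (Discrete I) C]

lemma quasiIso_coprod {K K' : Discrete I ⥤ CochainComplex C ℤ} (c : Cocone K) (c' : Cocone K')
    (hc : IsColimit c) (hc' : IsColimit c') (t : K ⟶ K') (ht : ∀ i, QuasiIso (t.app i)) :
    QuasiIso (hc.map c' t) := by
  rw [quasiIso_iff]
  intro n
  rw [quasiIsoAt_iff_isIso_homologyMap]
  let H := HomologicalComplex.homologyFunctor C (ComplexShape.up ℤ) n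
  have hiso (i) : IsIso (H.map (t.app i)) := by
    have := ht i
    exact (quasiIsoAt_iff_isIso_homologyMap (t.app i) n).1 inferInstance
  have hα (i) : IsIso ((Functor.whiskerRight t H).app i) := hiso i
  have hα' : IsIso (Functor.whiskerRight t H) := NatIso.isIso_of_isIso_app _
  let e := IsColimit.coconePointsIsoOfNatIso (isColimitOfPreserves H hc)
    (isColimitOfPreserves H hc') (asIso (Functor.whiskerRight t H))
  have he : HomologicalComplex.homologyMap (hc.map c' t) n = e.hom := by
    refine (isColimitOfPreserves H hc).hom_ext (fun i => ?_)
    refine Eq.trans ?_ (IsColimit.comp_coconePointsIsoOfNatIso_hom (isColimitOfPreserves H hc)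
      (isColimitOfPreserves H hc') (asIso (Functor.whiskerRight t H)) i).symm
    change H.map (c.ι.app i) ≫ H.map (hc.map c' t) = H.map (t.app i) ≫ H.map (c'.ι.app i)
    rw [← H.map_comp, ← H.map_comp, IsColimit.ι_map]
  rw [he]
  exact e.isIso_hom

open DerivedCategory in
instance Q_preservesCoproducts :
    PreservesColimitsOfShape (Discrete I) (Q : CochainComplex C ℤ ⥤ DerivedCategory C) where
  preservesColimit {K} := by
    constructor
    intro c hc
    constructor
    apply IsColimit.ofExistsUnique
    intro s
    obtain ⟨L, ⟨e⟩⟩ : ∃ L, Nonempty (s.pt ≅ Q.obj L) := ⟨_, ⟨(Q.objObjPreimageIso s.pt).symm⟩⟩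
    have hs (i) := right_fac (X := K.obj i) (s.ι.app i ≫ e.hom)
    choose K' t ht g hg using hs
    let K'' : Discrete I ⥤ CochainComplex C ℤ := Discrete.functor (fun i => K' ⟨i⟩)
    let τ : K'' ⟶ K := Discrete.natTrans (fun i => t i)
    have hτ : ∀ i, QuasiIso (τ.app i) := fun i => by
      have := ht i
      exact (isIso_Q_map_iff_quasiIso _ _).1 this
    have hq := quasiIso_coprod _ c (colimit.isColimit K'') hc τ hτ
    have : IsIso (Q.map ((colimit.isColimit K'').map c τ)) :=
      (isIso_Q_map_iff_quasiIso _ _).2 hq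
    let F : Q.obj c.pt ⟶ Q.obj L := inv (Q.map ((colimit.isColimit K'').map c τ)) ≫
      Q.map (colimit.desc K'' (Cocone.mk L (Discrete.natTrans (fun i => g i))))
    have hF (i) : Q.map (c.ι.app i) ≫ F = inv (Q.map (t i)) ≫ Q.map (g i) := by
        have := ht i
        rw [IsIso.eq_inv_comp]
        have h1 : Q.map (t i) ≫ Q.map (c.ι.app i) =
            Q.map (colimit.ι K'' i) ≫ Q.map ((colimit.isColimit K'').map c τ) := by
          rw [← Q.map_comp, ← Q.map_comp]
          congr 1
          exact (IsColimit.ι_map (colimit.isColimit K'') c τ i).symm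
        rw [← Category.assoc, h1]
        simp only [F, Category.assoc, IsIso.hom_inv_id_assoc]
        rw [← Q.map_comp, colimit.ι_desc]
        rfl
    refine ⟨F ≫ e.inv, ?_, ?_⟩
    · intro i
      have h2 := hg i
      rw [← hF i] at h2
      change Q.map (c.ι.app i) ≫ F ≫ e.inv = s.ι.app i
      rw [← Category.assoc, ← h2]
      simp
    · intro m hm
      have key : ∀ G : Q.obj c.pt ⟶ Q.obj L, (∀ i, Q.map (c.ι.app i) ≫ G = 0) → G = 0 := by
        intro G hG
        obtain ⟨L', a, b, hb, rfl⟩ := left_fac G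
        have h1 (i) : Q.map (c.ι.app i ≫ a) = 0 := by
          have := hG i
          rwa [← Category.assoc, Preadditive.IsIso.comp_right_eq_zero, ← Q.map_comp] at this
        have h2 (i) := exists_qis_of_Q_map_eq_zero _ (h1 i)
        choose A r hr hra using h2
        let A' : Discrete I ⥤ CochainComplex C ℤ := Discrete.functor (fun i => A ⟨i⟩)
        let ρ : A' ⟶ K := Discrete.natTrans (fun i => r i)
        have hq := quasiIso_coprod _ c (colimit.isColimit A') hc ρ (fun i => hr i)
        have hi : IsIso (Q.map ((colimit.isColimit A').map c ρ)) :=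
          (isIso_Q_map_iff_quasiIso _ _).2 hq
        obtain ⟨H⟩ := nullHomotopic_of_cofan A' _ (colimit.isColimit A')
          ((colimit.isColimit A').map c ρ ≫ a) (fun i => by
            rw [← Category.assoc, IsColimit.ι_map, Category.assoc]
            exact hra i)
        have h3 := Q_map_eq_of_homotopy _ H
        rw [Q.map_comp, Q.map_zero, Preadditive.IsIso.comp_left_eq_zero] at h3
        rw [h3, zero_comp]
      have h4 : (show Q.obj c.pt ⟶ s.pt from m) ≫ e.hom - F = 0 := key _ (fun i => by
        rw [Preadditive.comp_sub, hF, ← hg i, ← hm i, sub_eq_zero]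
        exact (Category.assoc _ _ _).symm)
      rw [sub_eq_zero] at h4
      rw [← h4]
      simp
end QCoprod
end HEpiAux
end
end

section
universe w₁ w₂ w' v v₂ u₂
open CategoryTheory Limits
noncomputable section
namespace HEpiAux

section QCoprod
variable {C : Type u} [Category.{v} C] [Abelian C] {I : Type w'}
  [HasColimitsOfShape (Discrete I) C] [HasDerivedCategory.{w} C]
  [HasExactColimitsOfShape (Discrete I) C]

/-- lifting of discrete diagrams -/
lemma exists_lift_diagram (K : Discrete I ⥤ DerivedCategory C) :
    ∃ K' : Discrete I ⥤ CochainComplex C ℤ, Nonempty (K' ⋙ DerivedCategory.Q ≅ K) :=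
  ⟨Discrete.functor (fun i => DerivedCategory.Q.objPreimage (K.obj ⟨i⟩)),
    ⟨Discrete.natIso (fun i => DerivedCategory.Q.objObjPreimageIso (K.obj i))⟩⟩

instance hasCoproducts_derivedCategory :
    HasColimitsOfShape (Discrete I) (DerivedCategory C) where
  has_colimit K := by
    obtain ⟨K', ⟨e⟩⟩ := exists_lift_diagram K
    exact hasColimit_of_iso e.symm

lemma preservesCoproducts_of_comp_Q {E : Type*} [Category E] (G : DerivedCategory C ⥤ E)
    [PreservesColimitsOfShape (Discrete I)
      ((DerivedCategory.Q : CochainComplex C ℤ ⥤ _) ⋙ G)] :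
    PreservesColimitsOfShape (Discrete I) G where
  preservesColimit {K} := by
    obtain ⟨K', ⟨e⟩⟩ := exists_lift_diagram K
    have : PreservesColimit (K' ⋙ DerivedCategory.Q) G := by
      refine preservesColimit_of_preserves_colimit_cocone
        (isColimitOfPreserves DerivedCategory.Q (colimit.isColimit K')) ?_
      exact isColimitOfPreserves ((DerivedCategory.Q : CochainComplex C ℤ ⥤ _) ⋙ G)
        (colimit.isColimit K')
    exact preservesColimit_of_iso_diagram G e

instance homology_preservesCoproducts (n : ℤ) :
    PreservesColimitsOfShape (Discrete I) (DerivedCategory.homologyFunctor C n) := by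
  have := preservesColimitsOfShape_of_natIso (J := Discrete I)
    (DerivedCategory.homologyFunctorFactors C n).symm
  exact preservesCoproducts_of_comp_Q _

variable {E : Type u₂} [Category.{v₂} E] [Abelian E]
  [HasColimitsOfShape (Discrete I) E] [HasDerivedCategory.{w₂} E]
  [HasExactColimitsOfShape (Discrete I) E] (F : C ⥤ E) [F.Additive]
  [PreservesFiniteLimits F] [PreservesFiniteColimits F] [PreservesColimitsOfShape (Discrete I) F]

lemma mapHC_preservesCoproducts :
    PreservesColimitsOfShape (Discrete I) (F.mapHomologicalComplex (ComplexShape.up ℤ)) where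
  preservesColimit {K} := by
    constructor
    intro c hc
    constructor
    apply HomologicalComplex.isColimitOfEval
    intro n
    exact isColimitOfPreserves F
      (isColimitOfPreserves (HomologicalComplex.eval C (ComplexShape.up ℤ) n) hc)

lemma mapDerived_preservesCoproducts :
    PreservesColimitsOfShape (Discrete I) F.mapDerivedCategory := by
  have := mapHC_preservesCoproducts (I := I) F
  have := preservesColimitsOfShape_of_natIso (J := Discrete I) F.mapDerivedCategoryFactors.symm
  exact preservesCoproducts_of_comp_Q _

end QCoprod
end HEpiAux
end
end

section
universe w' v₁ u₁ v₂ u₂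
open CategoryTheory Limits Pretriangulated
noncomputable section
namespace HEpiAux

section FF
variable {C : Type u₁} [Category.{v₁} C] [HasZeroObject C] [HasShift C ℤ] [Preadditive C]
  [∀ n : ℤ, (shiftFunctor C n).Additive] [Pretriangulated C]
  {D : Type u₂} [Category.{v₂} D] [HasZeroObject D] [HasShift D ℤ] [Preadditive D]
  [∀ n : ℤ, (shiftFunctor D n).Additive] [Pretriangulated D]
  (F : C ⥤ D) [F.CommShift ℤ] [F.IsTriangulated]

/-- `F` is fully faithful at `(X, Y)` -/
def FFAt {C : Type u₁} [Category.{v₁} C] {D : Type u₂} [Category.{v₂} D] (F : C ⥤ D)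
    (X Y : C) : Prop := Function.Bijective (F.map : (X ⟶ Y) → (F.obj X ⟶ F.obj Y))

lemma FFAt.of_iso {C : Type u₁} [Category.{v₁} C] {D : Type u₂} [Category.{v₂} D] {F : C ⥤ D}
    {X X' Y Y' : C} (h : FFAt F X Y) (e : X ≅ X') (e' : Y ≅ Y') : FFAt F X' Y' := by
  constructor
  · intro f g hfg
    have := h.1 (a₁ := e.hom ≫ f ≫ e'.inv) (a₂ := e.hom ≫ g ≫ e'.inv) (by simp [hfg])
    simpa using this
  · intro f
    obtain ⟨g, hg⟩ := h.2 (F.map e.hom ≫ f ≫ F.map e'.inv)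
    refine ⟨e.inv ≫ g ≫ e'.hom, ?_⟩
    rw [F.map_comp, F.map_comp, hg]
    simp only [Category.assoc, ← F.map_comp, Iso.inv_hom_id, F.map_id, Category.comp_id]
    rw [← Category.assoc, ← F.map_comp, Iso.inv_hom_id, F.map_id, Category.id_comp]

lemma FFAt.shift {F : C ⥤ D} [F.CommShift ℤ] {X Y : C} (h : FFAt F X Y) (n : ℤ) :
    FFAt F (X⟦n⟧) (Y⟦n⟧) := by
  constructor
  · intro f g hfg
    obtain ⟨f, rfl⟩ := (shiftFunctor C n).map_surjective f
    obtain ⟨g, rfl⟩ := (shiftFunctor C n).map_surjective g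
    congr 1
    apply h.1
    apply (shiftFunctor D n).map_injective
    have h1 := (F.commShiftIso n).hom.naturality f
    have h2 := (F.commShiftIso n).hom.naturality g
    dsimp at h1 h2 
    rw [← cancel_epi ((F.commShiftIso n).hom.app X), ← h1, ← h2, hfg]
  · intro f
    obtain ⟨f', hf'⟩ := (shiftFunctor D n).map_surjective
      ((F.commShiftIso n).inv.app X ≫ f ≫ (F.commShiftIso n).hom.app Y)
    obtain ⟨g, rfl⟩ := h.2 f'
    refine ⟨(shiftFunctor C n).map g, ?_⟩
    have h1 := (F.commShiftIso n).hom.naturality g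
    dsimp at h1
    rw [hf'] at h1
    rw [← cancel_mono ((F.commShiftIso n).hom.app Y), h1]
    simp

/-- all `X` such that `F` is fully faithful on maps out of `X` -/
def FFFrom {C : Type u₁} [Category.{v₁} C] {D : Type u₂} [Category.{v₂} D] (F : C ⥤ D)
    (X : C) : Prop := ∀ Y, FFAt F X Y

lemma FFFrom.of_iso {C : Type u₁} [Category.{v₁} C] {D : Type u₂} [Category.{v₂} D] {F : C ⥤ D}
    {X X' : C} (h : FFFrom F X) (e : X ≅ X') : FFFrom F X' :=
  fun Y => (h Y).of_iso e (Iso.refl _)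

lemma FFFrom.shift {F : C ⥤ D} [F.CommShift ℤ] {X : C} (h : FFFrom F X) (n : ℤ) :
    FFFrom F (X⟦n⟧) := fun Y =>
  ((h (Y⟦-n⟧)).shift n).of_iso (Iso.refl _) ((shiftEquiv C n).counitIso.app Y)

lemma FFFrom.cone {F : C ⥤ D} [F.CommShift ℤ] [F.IsTriangulated] {T : Triangle C}
    (hT : T ∈ distTriang C) (h₁ : FFFrom F T.obj₁) (h₂ : FFFrom F T.obj₂) :
    FFFrom F T.obj₃ := by
  intro Y
  have hF := F.map_distinguished T hT
  constructor
  · refine (injective_iff_map_eq_zero (F.mapAddHom (X := T.obj₃) (Y := Y))).2 ?_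
    intro f hf
    replace hf : F.map f = 0 := hf
    have h0 : T.mor₂ ≫ f = 0 := (h₂ Y).1 (by rw [F.map_comp, hf, comp_zero, F.map_zero])
    obtain ⟨g, rfl⟩ := T.yoneda_exact₃ hT f h0
    have hF' := F.map_distinguished _ (rot_of_distTriang _ hT)
    obtain ⟨k, hk⟩ : ∃ k : (F.obj T.obj₂)⟦(1 : ℤ)⟧ ⟶ F.obj Y, F.map g =
        (F.map (-(T.mor₁⟦(1 : ℤ)⟧')) ≫ (F.commShiftIso (1 : ℤ)).hom.app T.obj₂) ≫ k :=
        Triangle.yoneda_exact₃ _ hF' (F.map g) (by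
      change F.map T.mor₃ ≫ F.map g = 0
      rw [← F.map_comp, hf])
    obtain ⟨k', hk'⟩ := (h₂.shift 1 Y).2 ((F.commShiftIso (1 : ℤ)).hom.app _ ≫ k)
    have : g = (-(T.mor₁⟦(1 : ℤ)⟧')) ≫ k' := by
      apply (h₁.shift 1 Y).1
      have h3 : F.map ((-(T.mor₁⟦(1 : ℤ)⟧')) ≫ k') =
        F.map (-(T.mor₁⟦(1 : ℤ)⟧')) ≫ (F.commShiftIso (1 : ℤ)).hom.app T.obj₂ ≫ k := by
        rw [← hk']; exact F.map_comp _ _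
      exact hk.trans ((Category.assoc _ _ _).trans h3.symm)
    rw [this]
    simp [comp_distTriang_mor_zero₃₁_assoc _ hT]
  · intro f
    obtain ⟨a, ha⟩ := (h₂ Y).2 (F.map T.mor₂ ≫ f)
    have h0 : T.mor₁ ≫ a = 0 := (h₁ Y).1 (by
      rw [F.map_comp, ha, ← Category.assoc, ← F.map_comp, comp_distTriang_mor_zero₁₂ _ hT]
      simp)
    obtain ⟨b, rfl⟩ := T.yoneda_exact₂ hT a h0
    obtain ⟨k, hk⟩ : ∃ k : (F.obj T.obj₁)⟦(1 : ℤ)⟧ ⟶ F.obj Y, f - F.map b =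
        (F.map T.mor₃ ≫ (F.commShiftIso (1 : ℤ)).hom.app T.obj₁) ≫ k :=
        Triangle.yoneda_exact₃ _ hF (f - F.map b) (by
      change F.map T.mor₂ ≫ (f - F.map b) = 0
      rw [Preadditive.comp_sub, ← ha, F.map_comp, sub_self])
    obtain ⟨k', hk'⟩ := (h₁.shift 1 Y).2 ((F.commShiftIso (1 : ℤ)).hom.app _ ≫ k)
    refine ⟨b + T.mor₃ ≫ k', ?_⟩
    have h3 : F.map (T.mor₃ ≫ k') = (F.map T.mor₃ ≫
        (F.commShiftIso (1 : ℤ)).hom.app T.obj₁) ≫ k := by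
      rw [F.map_comp, hk']
      exact (Category.assoc _ _ _).symm
    rw [F.map_add, h3, ← hk]
    abel

lemma FFAt.of_triangle {X : C} {T : Triangle C}
    (hT : T ∈ distTriang C) (h₁ : FFAt F X T.obj₁) (h₃ : FFAt F X T.obj₃)
    (hi : ∀ f : X ⟶ T.obj₁⟦(1 : ℤ)⟧, F.map f = 0 → f = 0)
    (hs : Function.Surjective (F.map : (X ⟶ T.obj₃⟦(-1 : ℤ)⟧) → _)) :
    FFAt F X T.obj₂ := by
  have hF := F.map_distinguished T hT
  constructor
  · refine (injective_iff_map_eq_zero (F.mapAddHom (X := X) (Y := T.obj₂))).2 ?_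
    intro f hf
    replace hf : F.map f = 0 := hf
    have h0 : f ≫ T.mor₂ = 0 := h₃.1 (by rw [F.map_comp, hf, zero_comp, F.map_zero])
    obtain ⟨g, rfl⟩ := T.coyoneda_exact₂ hT f h0
    have hT' := inv_rot_of_distTriang _ hT
    have hF' := F.map_distinguished _ hT'
    obtain ⟨k, hk⟩ := Triangle.coyoneda_exact₂ _ hF' (F.map g) (by
      change F.map g ≫ F.map T.mor₁ = 0
      rw [← F.map_comp, hf])
    obtain ⟨k', rfl⟩ := hs k
    have : g = k' ≫ T.invRotate.mor₁ := by
      apply h₁.1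
      exact hk.trans (F.map_comp _ _).symm
    have hz : T.invRotate.mor₁ ≫ T.mor₁ = 0 := comp_distTriang_mor_zero₁₂ _ hT'
    rw [this]
    exact (Category.assoc _ _ _).trans ((congrArg (k' ≫ ·) hz).trans comp_zero)
  · intro f
    obtain ⟨a, ha⟩ := h₃.2 (f ≫ F.map T.mor₂)
    have h0 : a ≫ T.mor₃ = 0 := hi _ (by
      rw [F.map_comp, ha, Category.assoc, ← F.map_comp, comp_distTriang_mor_zero₂₃ _ hT]
      simp)
    obtain ⟨b, rfl⟩ := T.coyoneda_exact₃ hT a h0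
    obtain ⟨k, hk⟩ := Triangle.coyoneda_exact₂ _ hF (f - F.map b) (by
      change (f - F.map b) ≫ F.map T.mor₂ = 0
      rw [Preadditive.sub_comp, ← ha, F.map_comp, sub_self])
    obtain ⟨k', rfl⟩ := h₁.2 k
    refine ⟨b + k' ≫ T.mor₁, ?_⟩
    rw [F.map_add, F.map_comp]
    exact (add_comm _ _).trans (sub_eq_iff_eq_add.1 hk).symm

lemma FFFrom.coprod {C : Type u₁} [Category.{v₁} C] {D : Type u₂} [Category.{v₂} D] {F : C ⥤ D}
    {I : Type w'} [PreservesColimitsOfShape (Discrete I) F] {K : Discrete I ⥤ C}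
    {c : Cocone K} (hc : IsColimit c) (h : ∀ i, FFFrom F (K.obj i)) : FFFrom F c.pt := by
  intro Y
  constructor
  · intro f g hfg
    apply hc.hom_ext
    intro i
    apply (h i Y).1
    rw [F.map_comp, F.map_comp, hfg]
  · intro f
    choose g hg using fun i => (h i Y).2 (F.map (c.ι.app i) ≫ f)
    refine ⟨hc.desc (Cocone.mk Y (Discrete.natTrans g)), ?_⟩
    apply (isColimitOfPreserves F hc).hom_ext
    intro i
    change F.map (c.ι.app i) ≫ _ = F.map (c.ι.app i) ≫ f
    rw [← hg, ← F.map_comp, hc.fac]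
    rfl
end FF
end HEpiAux
end
end

section
open CategoryTheory Limits Pretriangulated
noncomputable section
namespace HEpiAux

section Gen
variable {S : Type u} [Ring S]

lemma exists_single_elt (K : CochainComplex (ModuleCat.{u} S) ℤ) (n : ℤ) (x : K.homology n) :
    ∃ (g : (HomologicalComplex.single (ModuleCat.{u} S) (ComplexShape.up ℤ) n).obj
      (ModuleCat.of S S) ⟶ K),
      ∃ y, HomologicalComplex.homologyMap g n y = x := by
  have hsurj := (ModuleCat.epi_iff_surjective (K.homologyπ n)).1 inferInstance
  obtain ⟨z, rfl⟩ := hsurj x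
  let s : ModuleCat.of S S ⟶ K.cycles n := ModuleCat.ofHom (LinearMap.toSpanSingleton S _ z)
  let L := (HomologicalComplex.single (ModuleCat.{u} S) (ComplexShape.up ℤ) n).obj
      (ModuleCat.of S S)
  let g : L ⟶ K := HomologicalComplex.mkHomFromSingle (s ≫ K.iCycles n) (fun k _ => by simp)
  let t : ModuleCat.of S S ⟶ L.cycles n := L.liftCycles
      (HomologicalComplex.singleObjXSelf (ComplexShape.up ℤ) n (ModuleCat.of S S)).inv (n+1)
        (by simp) (by simp [L])
  have ht : t ≫ HomologicalComplex.cyclesMap g n = s := by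
    rw [← cancel_mono (K.iCycles n)]
    simp [t, g]
  refine ⟨g, L.homologyπ n (t (1 : S)), ?_⟩
  have h1 := congrArg (fun f => f (1 : S)) 
    (congrArg (fun f => ModuleCat.Hom.hom (t ≫ f)) (HomologicalComplex.homologyπ_naturality g n))
  have h2 := congrArg (fun f => (ModuleCat.Hom.hom f) (1 : S)) ht
  have h3 : s (1 : S) = z := by
    change (1 : S) • z = z
    exact one_smul _ _
  refine h1.trans ?_
  change K.homologyπ n (HomologicalComplex.cyclesMap g n (t (1 : S))) = _
  rw [← h3]
  exact congrArg _ h2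

variable [HasDerivedCategory.{w} (ModuleCat.{u} S)]

/-- A localizing subcategory (given by a predicate) containing all `S[n]`. -/
structure IsLoc (P : DerivedCategory (ModuleCat.{u} S) → Prop) : Prop where
  iso : ∀ {X Y}, (X ≅ Y) → P X → P Y
  cone : ∀ {T : Triangle (DerivedCategory (ModuleCat.{u} S))},
    T ∈ distTriang _ → P T.obj₁ → P T.obj₂ → P T.obj₃
  coprod : ∀ {I : Type u} (X : I → DerivedCategory (ModuleCat.{u} S)), (∀ i, P (X i)) → P (∐ X)
  gen : ∀ n : ℤ, P ((DerivedCategory.singleFunctor _ n).obj (ModuleCat.of S S))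

variable {P : DerivedCategory (ModuleCat.{u} S) → Prop}

lemma exists_single_elt' (X : DerivedCategory (ModuleCat.{u} S)) (n : ℤ)
    (x : (DerivedCategory.homologyFunctor (ModuleCat.{u} S) n).obj X) :
    ∃ (g : (DerivedCategory.singleFunctor _ n).obj (ModuleCat.of S S) ⟶ X),
      ∃ y, (DerivedCategory.homologyFunctor (ModuleCat.{u} S) n).map g y = x := by
  let K := DerivedCategory.Q.objPreimage X
  let e : DerivedCategory.Q.obj K ≅ X := DerivedCategory.Q.objObjPreimageIso X
  let H := DerivedCategory.homologyFunctor (ModuleCat.{u} S) n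
  let ε := (DerivedCategory.homologyFunctorFactors (ModuleCat.{u} S) n)
  obtain ⟨g, y, hy⟩ := exists_single_elt K n (ε.hom.app K (H.map e.inv x))
  refine ⟨DerivedCategory.Q.map g ≫ e.hom, ε.inv.app _ y, ?_⟩
  have h1 : ε.inv.app _ ≫ H.map (DerivedCategory.Q.map g) =
    HomologicalComplex.homologyMap g n ≫ ε.inv.app _ := (ε.inv.naturality g).symm
  have h2 := congrArg (fun f => (ModuleCat.Hom.hom f) y) h1
  change H.map (DerivedCategory.Q.map g) (ε.inv.app _ y) =
    ε.inv.app _ (HomologicalComplex.homologyMap g n y) at h2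
  have h3 : H.map (DerivedCategory.Q.map g ≫ e.hom) (ε.inv.app _ y) =
      H.map e.hom (H.map (DerivedCategory.Q.map g) (ε.inv.app _ y)) := by
    rw [H.map_comp]; rfl
  refine h3.trans ?_
  rw [h2, hy]
  have h4 : ε.hom.app K ≫ ε.inv.app K = 𝟙 _ := by simp
  have h5 : ε.inv.app K (ε.hom.app K (H.map e.inv x)) = H.map e.inv x :=
    congrArg (fun f => (ModuleCat.Hom.hom f) (H.map e.inv x)) h4
  refine (congrArg _ h5).trans ?_
  have h6 : H.map e.inv ≫ H.map e.hom = 𝟙 _ := by simp [← H.map_comp]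
  exact congrArg (fun f => (ModuleCat.Hom.hom f) x) h6

lemma IsLoc.exists_cover (hP : IsLoc P) (X : DerivedCategory (ModuleCat.{u} S)) :
    ∃ (Y : DerivedCategory (ModuleCat.{u} S)) (_ : P Y) (p : Y ⟶ X),
      ∀ n : ℤ, Epi ((DerivedCategory.homologyFunctor _ n).map p) := by
  let I := Σ n : ℤ, (DerivedCategory.homologyFunctor (ModuleCat.{u} S) n).obj X
  choose g y hy using fun i : I => exists_single_elt' X i.1 i.2
  refine ⟨∐ (fun i : I => (DerivedCategory.singleFunctor _ i.1).obj (ModuleCat.of S S)),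
    hP.coprod _ (fun i => hP.gen _), Sigma.desc g, fun n => ?_⟩
  rw [ModuleCat.epi_iff_surjective]
  intro x
  refine ⟨(DerivedCategory.homologyFunctor (ModuleCat.{u} S) n).map
    (Sigma.ι (fun i : I => (DerivedCategory.singleFunctor _ i.1).obj (ModuleCat.of S S))
      ⟨n, x⟩) (y ⟨n, x⟩), ?_⟩
  refine Eq.trans ?_ (hy ⟨n, x⟩)
  have := Sigma.ι_desc g ⟨n, x⟩
  conv_rhs => rw [← this, Functor.map_comp]
  rfl

lemma IsLoc.step (hP : IsLoc P) {X' X : DerivedCategory (ModuleCat.{u} S)} (h : P X')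
    (f : X' ⟶ X) :
    ∃ (X'' : DerivedCategory (ModuleCat.{u} S)) (_ : P X'') (j : X' ⟶ X'') (f' : X'' ⟶ X),
      j ≫ f' = f ∧ ∀ (n : ℤ) (x : (DerivedCategory.homologyFunctor (ModuleCat.{u} S) n).obj X'),
        (DerivedCategory.homologyFunctor _ n).map f x = 0 →
          (DerivedCategory.homologyFunctor _ n).map j x = 0 := by
  obtain ⟨Z, z, d, hT⟩ := distinguished_cocone_triangle₁ f
  obtain ⟨Y, hY, p, hp⟩ := hP.exists_cover Z
  obtain ⟨X'', j, d', hT'⟩ := distinguished_cocone_triangle (p ≫ z)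
  obtain ⟨f', hf'⟩ := Triangle.yoneda_exact₂ _ hT' f (by
    change (p ≫ z) ≫ f = 0
    rw [Category.assoc]
    have : z ≫ f = 0 := comp_distTriang_mor_zero₁₂ _ hT
    rw [this, comp_zero])
  refine ⟨X'', hP.cone hT' hY h, j, f', hf'.symm, fun n x hx => ?_⟩
  have ex := DerivedCategory.HomologySequence.exact₂ _ hT n
  rw [ShortComplex.moduleCat_exact_iff] at ex
  obtain ⟨a, rfl⟩ := ex x hx
  obtain ⟨b, rfl⟩ := (ModuleCat.epi_iff_surjective _).1 (hp n) a
  have h0 : (p ≫ z) ≫ j = 0 := comp_distTriang_mor_zero₁₂ _ hT'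
  have h1 : (DerivedCategory.homologyFunctor (ModuleCat.{u} S) n).map p ≫
    (DerivedCategory.homologyFunctor (ModuleCat.{u} S) n).map z ≫
    (DerivedCategory.homologyFunctor (ModuleCat.{u} S) n).map j = 0 := by
    rw [← Functor.map_comp, ← Functor.map_comp, ← Category.assoc, h0, Functor.map_zero]
  exact congrArg (fun f => (ModuleCat.Hom.hom f) b) h1

end Gen
end HEpiAux
end
end

section
open CategoryTheory Limits Pretriangulated
noncomputable section
namespace HEpiAux

section Tel
variable {S : Type u} [Ring S]

lemma iSup_range_eq_top {J : Type*} {K : Discrete J ⥤ ModuleCat.{u} S} {c : Cocone K}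
    (hc : IsColimit c) :
    (⨆ i, LinearMap.range (show K.obj i →ₗ[S] c.pt from (c.ι.app i).hom)) = ⊤ := by
  let N := ⨆ i, LinearMap.range (show K.obj i →ₗ[S] c.pt from (c.ι.app i).hom)
  have : ModuleCat.ofHom N.mkQ = 0 := by
    apply hc.hom_ext
    intro i
    rw [comp_zero]
    ext x
    change N.mkQ ((c.ι.app i).hom x) = 0
    rw [Submodule.mkQ_apply, Submodule.Quotient.mk_eq_zero]
    exact Submodule.mem_iSup_of_mem i ⟨x, rfl⟩
  have h2 := congrArg (fun f => LinearMap.ker (ModuleCat.Hom.hom f)) this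
  simpa using h2

variable [HasDerivedCategory.{w} (ModuleCat.{u} S)]
  (X : ℕ → DerivedCategory (ModuleCat.{u} S)) (j : ∀ k, X k ⟶ X (k + 1))

/-- the countable coproduct -/
def tot : DerivedCategory (ModuleCat.{u} S) := ∐ (fun k : ULift.{u} ℕ => X k.down)

/-- the inclusions -/
def totι (k : ℕ) : X k ⟶ tot X := Sigma.ι (fun k : ULift.{u} ℕ => X k.down) ⟨k⟩

variable {X} in
/-- universal property -/
def totDesc {Y : DerivedCategory (ModuleCat.{u} S)} (f : ∀ k, X k ⟶ Y) : tot X ⟶ Y :=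
  Sigma.desc (fun k => f k.down)

variable {X} in
lemma totι_desc {Y : DerivedCategory (ModuleCat.{u} S)} (f : ∀ k, X k ⟶ Y) (k : ℕ) :
    totι X k ≫ totDesc f = f k := Sigma.ι_desc _ _

variable {X} in
lemma tot_hom_ext {Y : DerivedCategory (ModuleCat.{u} S)} {f g : tot X ⟶ Y}
    (h : ∀ k, totι X k ≫ f = totι X k ≫ g) : f = g := Sigma.hom_ext _ _ (fun k => h k.down)

lemma tot_induction (n : ℤ) {p : (DerivedCategory.homologyFunctor (ModuleCat.{u} S) n).obj (tot X) → Prop} (h0 : p 0)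
    (h1 : ∀ k x, p ((DerivedCategory.homologyFunctor (ModuleCat.{u} S) n).map (totι X k) x)) (h2 : ∀ x y, p x → p y → p (x + y))
    (x : (DerivedCategory.homologyFunctor (ModuleCat.{u} S) n).obj (tot X)) : p x := by
  have hc := isColimitOfPreserves (DerivedCategory.homologyFunctor (ModuleCat.{u} S) n)
    (colimit.isColimit (Discrete.functor (fun k : ULift.{u} ℕ => X k.down)))
  have := iSup_range_eq_top hc
  refine Submodule.iSup_induction _ (motive := p) (x := x) (this.ge trivial) ?_ h0 h2
  rintro ⟨⟨k⟩⟩ _ ⟨y, rfl⟩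
  exact h1 k y

/-- the projections -/
def totπ (k : ℕ) : tot X ⟶ X k :=
  totDesc (fun l => if h : l = k then eqToHom (by rw [h]) else 0)

lemma totι_π_self (k : ℕ) : totι X k ≫ totπ X k = 𝟙 _ := by
  simp [totπ, totι_desc]

lemma totι_π_ne {k l : ℕ} (h : l ≠ k) : totι X l ≫ totπ X k = 0 := by
  simp [totπ, totι_desc, h]

/-- one minus shift -/
def oms : tot X ⟶ tot X := totDesc (fun k => totι X k - j k ≫ totι X (k + 1))

lemma oms_π_zero : oms X j ≫ totπ X 0 = totπ X 0 := by
  apply tot_hom_ext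
  intro k
  rw [oms, reassoc_of% (totι_desc (X := X)), Preadditive.sub_comp, Category.assoc,
    totι_π_ne X (Nat.succ_ne_zero k), comp_zero, sub_zero]

lemma oms_π_succ (l : ℕ) : oms X j ≫ totπ X (l + 1) = totπ X (l + 1) - totπ X l ≫ j l := by
  apply tot_hom_ext
  intro k
  rw [oms, reassoc_of% (totι_desc (X := X)), Preadditive.sub_comp, Category.assoc, Preadditive.comp_sub]
  congr 1
  by_cases h : k = l
  · subst h
    rw [totι_π_self, reassoc_of% (totι_π_self X k), Category.comp_id]
  · rw [totι_π_ne X (by omega : k + 1 ≠ l + 1), reassoc_of% (totι_π_ne X h), comp_zero, zero_comp]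

lemma map_comp_apply (n : ℤ) {A B C : DerivedCategory (ModuleCat.{u} S)} (f : A ⟶ B) (g : B ⟶ C)
    (x : (DerivedCategory.homologyFunctor (ModuleCat.{u} S) n).obj A) : (DerivedCategory.homologyFunctor (ModuleCat.{u} S) n).map (f ≫ g) x = (DerivedCategory.homologyFunctor (ModuleCat.{u} S) n).map g ((DerivedCategory.homologyFunctor (ModuleCat.{u} S) n).map f x) := by
  rw [Functor.map_comp]; rfl

lemma map_sub_apply (n : ℤ) {A B : DerivedCategory (ModuleCat.{u} S)} (f g : A ⟶ B)
    (x : (DerivedCategory.homologyFunctor (ModuleCat.{u} S) n).obj A) : (DerivedCategory.homologyFunctor (ModuleCat.{u} S) n).map (f - g) x = (DerivedCategory.homologyFunctor (ModuleCat.{u} S) n).map f x - (DerivedCategory.homologyFunctor (ModuleCat.{u} S) n).map g x := by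
  rw [Functor.map_sub]; rfl

lemma map_zero_apply (n : ℤ) {A B : DerivedCategory (ModuleCat.{u} S)}
    (x : (DerivedCategory.homologyFunctor (ModuleCat.{u} S) n).obj A) : (DerivedCategory.homologyFunctor (ModuleCat.{u} S) n).map (0 : A ⟶ B) x = 0 := by
  rw [Functor.map_zero]; rfl

lemma map_id_apply (n : ℤ) {A : DerivedCategory (ModuleCat.{u} S)}
    (x : (DerivedCategory.homologyFunctor (ModuleCat.{u} S) n).obj A) : (DerivedCategory.homologyFunctor (ModuleCat.{u} S) n).map (𝟙 A) x = x := by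
  rw [CategoryTheory.Functor.map_id]; rfl

lemma tot_decomp (n : ℤ) (x : (DerivedCategory.homologyFunctor (ModuleCat.{u} S) n).obj (tot X)) :
    ∃ N : ℕ, ∀ M, N ≤ M → x = ∑ k ∈ Finset.range M,
      (DerivedCategory.homologyFunctor (ModuleCat.{u} S) n).map (totι X k) ((DerivedCategory.homologyFunctor (ModuleCat.{u} S) n).map (totπ X k) x) := by
  induction x using tot_induction with
  | h0 => exact ⟨0, fun M _ => by simp⟩
  | h1 k x =>
    refine ⟨k + 1, fun M hM => ?_⟩
    rw [Finset.sum_eq_single k]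
    · rw [← map_comp_apply n (totι X k) (totπ X k), totι_π_self, map_id_apply]
    · intro l _ hl
      rw [← map_comp_apply n (totι X k) (totπ X l), totι_π_ne X hl.symm, map_zero_apply, map_zero]
    · intro h
      simp only [Finset.mem_range] at h
      omega
  | h2 x y hx hy =>
    obtain ⟨N, hN⟩ := hx
    obtain ⟨N', hN'⟩ := hy
    refine ⟨max N N', fun M hM => ?_⟩
    simp only [map_add, Finset.sum_add_distrib]
    rw [← hN M (le_trans (le_max_left _ _) hM), ← hN' M (le_trans (le_max_right _ _) hM)]

lemma tot_eq_zero (n : ℤ) (x : (DerivedCategory.homologyFunctor (ModuleCat.{u} S) n).obj (tot X)) (h : ∀ k, (DerivedCategory.homologyFunctor (ModuleCat.{u} S) n).map (totπ X k) x = 0) :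
    x = 0 := by
  obtain ⟨N, hN⟩ := tot_decomp X n x
  rw [hN N le_rfl]
  apply Finset.sum_eq_zero
  intro k _
  rw [h k, map_zero]

lemma oms_mono (n : ℤ) : Mono ((DerivedCategory.homologyFunctor (ModuleCat.{u} S) n).map (oms X j)) := by
  rw [ModuleCat.mono_iff_injective]
  refine (injective_iff_map_eq_zero ((DerivedCategory.homologyFunctor (ModuleCat.{u} S) n).map (oms X j)).hom).2 ?_
  intro x hx
  replace hx : (DerivedCategory.homologyFunctor (ModuleCat.{u} S) n).map (oms X j) x = 0 := hx
  apply tot_eq_zero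
  intro k
  induction k with
  | zero => rw [← oms_π_zero X j, map_comp_apply, hx, map_zero]
  | succ k ih =>
    have h1 := map_comp_apply n (oms X j) (totπ X (k + 1)) x
    rw [oms_π_succ, hx, map_zero, map_sub_apply, map_comp_apply, ih, map_zero, sub_zero] at h1
    exact h1

lemma tot_repr (n : ℤ) (x : (DerivedCategory.homologyFunctor (ModuleCat.{u} S) n).obj (tot X)) :
    ∃ N : ℕ, ∀ M, N ≤ M → ∃ (c : (DerivedCategory.homologyFunctor (ModuleCat.{u} S) n).obj (X M)) (y : (DerivedCategory.homologyFunctor (ModuleCat.{u} S) n).obj (tot X)),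
      x = (DerivedCategory.homologyFunctor (ModuleCat.{u} S) n).map (totι X M) c + (DerivedCategory.homologyFunctor (ModuleCat.{u} S) n).map (oms X j) y := by
  induction x using tot_induction with
  | h0 => exact ⟨0, fun M _ => ⟨0, 0, by simp⟩⟩
  | h1 k x =>
    refine ⟨k, fun M hM => ?_⟩
    induction M, hM using Nat.le_induction with
    | base => exact ⟨x, 0, by simp⟩
    | succ M hM ih =>
      obtain ⟨c, y, h⟩ := ih
      refine ⟨(DerivedCategory.homologyFunctor (ModuleCat.{u} S) n).map (j M) c, (DerivedCategory.homologyFunctor (ModuleCat.{u} S) n).map (totι X M) c + y, ?_⟩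
      rw [map_add, ← map_comp_apply n (totι X M), oms, totι_desc, map_sub_apply,
        map_comp_apply, h, oms]
      abel
  | h2 x y hx hy =>
    obtain ⟨N, hN⟩ := hx
    obtain ⟨N', hN'⟩ := hy
    refine ⟨max N N', fun M hM => ?_⟩
    obtain ⟨c, a, h⟩ := hN M (le_trans (le_max_left _ _) hM)
    obtain ⟨c', a', h'⟩ := hN' M (le_trans (le_max_right _ _) hM)
    refine ⟨c + c', a + a', ?_⟩
    rw [h, h', map_add, map_add]
    abel

variable {P : DerivedCategory (ModuleCat.{u} S) → Prop}

lemma IsLoc.of_seq (hP : IsLoc P) (hX : ∀ k, P (X k)) {Y : DerivedCategory (ModuleCat.{u} S)}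
    (f : ∀ k, X k ⟶ Y) (hf : ∀ k, j k ≫ f (k + 1) = f k)
    (hepi : ∀ n, Epi ((DerivedCategory.homologyFunctor (ModuleCat.{u} S) n).map (f 0)))
    (hker : ∀ k n x, (DerivedCategory.homologyFunctor (ModuleCat.{u} S) n).map (f k) x = 0 → (DerivedCategory.homologyFunctor (ModuleCat.{u} S) n).map (j k) x = 0) : P Y := by
  obtain ⟨Z, p, d, hT⟩ := distinguished_cocone_triangle (oms X j)
  have hZ : P Z := hP.cone hT (hP.coprod _ fun k => hX _) (hP.coprod _ fun k => hX _)
  obtain ⟨v, hv⟩ : ∃ v : Z ⟶ Y, totDesc f = p ≫ v := Triangle.yoneda_exact₂ _ hT (totDesc f) (by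
    change oms X j ≫ totDesc f = 0
    apply tot_hom_ext
    intro k
    rw [oms, reassoc_of% (totι_desc (X := X)), Preadditive.sub_comp, Category.assoc, totι_desc, totι_desc,
      hf, sub_self, comp_zero])
  suffices IsIso v from hP.iso (asIso v) hZ
  rw [DerivedCategory.isIso_iff]
  intro n
  have hp : Epi ((DerivedCategory.homologyFunctor (ModuleCat.{u} S) n).map p) := by
    have h := (DerivedCategory.HomologySequence.mono_homologyMap_mor₁_iff _ hT n (n+1) rfl).1
      (oms_mono X j (n+1))
    exact (DerivedCategory.HomologySequence.epi_homologyMap_mor₂_iff _ hT n (n+1) rfl).2 h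
  have e1 : Epi ((DerivedCategory.homologyFunctor (ModuleCat.{u} S) n).map v) := by
    have h1 : (totι X 0 ≫ p) ≫ v = f 0 := by rw [Category.assoc, ← hv, totι_desc]
    have : Epi ((DerivedCategory.homologyFunctor (ModuleCat.{u} S) n).map (totι X 0 ≫ p) ≫ (DerivedCategory.homologyFunctor (ModuleCat.{u} S) n).map v) := by
      rw [← Functor.map_comp, h1]; exact hepi n
    exact epi_of_epi ((DerivedCategory.homologyFunctor (ModuleCat.{u} S) n).map (totι X 0 ≫ p)) _
  have e2 : Mono ((DerivedCategory.homologyFunctor (ModuleCat.{u} S) n).map v) := by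
    rw [ModuleCat.mono_iff_injective]
    refine (injective_iff_map_eq_zero ((DerivedCategory.homologyFunctor (ModuleCat.{u} S) n).map v).hom).2 ?_
    intro a ha
    replace ha : (DerivedCategory.homologyFunctor (ModuleCat.{u} S) n).map v a = 0 := ha
    obtain ⟨b, rfl⟩ := (ModuleCat.epi_iff_surjective _).1 hp a
    have hop : oms X j ≫ p = 0 := comp_distTriang_mor_zero₁₂ _ hT
    obtain ⟨N, hN⟩ := tot_repr X j n b
    obtain ⟨c, y, rfl⟩ := hN N le_rfl
    have h2 : (DerivedCategory.homologyFunctor (ModuleCat.{u} S) n).map p ((DerivedCategory.homologyFunctor (ModuleCat.{u} S) n).map (oms X j) y) = 0 := by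
      rw [← map_comp_apply, hop, map_zero_apply]
    rw [map_add, h2, add_zero] at ha ⊢
    rw [← map_comp_apply, ← map_comp_apply, ← hv, totι_desc] at ha
    have h3 := hker N n c ha
    have h4 : totι X N ≫ p = j N ≫ totι X (N + 1) ≫ p := by
      have : totι X N ≫ oms X j ≫ p = 0 := by rw [hop, comp_zero]
      rw [oms, reassoc_of% (totι_desc (X := X)), Preadditive.sub_comp, sub_eq_zero, Category.assoc] at this
      exact this
    rw [← map_comp_apply, h4, map_comp_apply, h3, map_zero]
  exact isIso_of_mono_of_epi _

theorem IsLoc.all (hP : IsLoc P) (Y : DerivedCategory (ModuleCat.{u} S)) : P Y := by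
  obtain ⟨X₀, h₀, p, hp⟩ := hP.exists_cover Y
  let A := Σ' (X : DerivedCategory (ModuleCat.{u} S)) (_ : X ⟶ Y), P X
  choose X'' hX'' jj f' hj hk using fun a : A => hP.step a.2.2 a.2.1
  let seq : ℕ → A := fun k => Nat.rec ⟨X₀, p, h₀⟩ (fun _ a => ⟨X'' a, f' a, hX'' a⟩) k
  exact hP.of_seq (fun k => (seq k).1) (fun k => jj (seq k)) (fun k => (seq k).2.2)
    (fun k => (seq k).2.1) (fun k => hj (seq k)) hp (fun k => hk (seq k))

end Tel
end HEpiAux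
end
end

open HEpiAux Pretriangulated

lemma F_bij_iff (M : ModuleCat.{u} S) :
    Function.Bijective (etaMap φ M) ↔
      FFAt (ModuleCat.restrictScalars.{u} φ) (ModuleCat.of S S) M := by
  let a : M → (ModuleCat.of S S ⟶ M) := fun m => ModuleCat.ofHom (LinearMap.toSpanSingleton S M m)
  have ha : Function.Bijective a := by
    constructor
    · intro m m' h
      have := congrArg (fun f => (ModuleCat.Hom.hom f) (1 : S)) h
      simpa [a] using this
    · intro f
      refine ⟨f.hom (1 : S), ?_⟩
      ext
      simp [a]
  let b : (SasR φ →ₗ[R] (ModuleCat.restrictScalars φ).obj M) ≃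
      (SasR φ ⟶ (ModuleCat.restrictScalars φ).obj M) := ModuleCat.homEquiv.symm
  have : b ∘ etaMap φ M = (ModuleCat.restrictScalars.{u} φ).map ∘ a := by
    ext m : 1
    rfl
  rw [← Function.Bijective.of_comp_iff' b.bijective, this, Function.Bijective.of_comp_iff _ ha]
  rfl

lemma single_bij_iff (N M : ModuleCat.{u} S) :
    FFAt (ModuleCat.restrictScalars.{u} φ) N M ↔
      FFAt (Dphi φ) ((singleFunctor _ 0).obj N) ((singleFunctor _ 0).obj M) := by
  let F := ModuleCat.restrictScalars.{u} φ
  let ε := F.mapDerivedCategorySingleFunctor 0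
  have hs : ∀ (C : Type (u + 1)) [Category.{u} C] [Abelian C] [HasDerivedCategory.{w} C] (X Y : C),
      Function.Bijective ((singleFunctor C 0).map : (X ⟶ Y) → _) := fun C _ _ _ X Y =>
    ⟨(singleFunctor C 0).map_injective, (singleFunctor C 0).map_surjective⟩
  let b : ((singleFunctor _ 0).obj (F.obj N) ⟶ (singleFunctor _ 0).obj (F.obj M)) ≃
      ((Dphi φ).obj ((singleFunctor _ 0).obj N) ⟶ (Dphi φ).obj ((singleFunctor _ 0).obj M)) :=
    Iso.homCongr (ε.app N).symm (ε.app M).symm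
  have : (fun f : N ⟶ M => (Dphi φ).map ((singleFunctor _ 0).map f)) =
      fun f => b ((singleFunctor _ 0).map (F.map f)) := by
    ext f
    have := ε.hom.naturality f
    change (Dphi φ).map ((singleFunctor _ 0).map f) = ε.hom.app N ≫ (singleFunctor _ 0).map (F.map f) ≫ ε.inv.app M
    rw [← Category.assoc]
    refine (ε.app M).eq_comp_inv.2 ?_
    exact this
  have h1 : FFAt (Dphi φ) ((singleFunctor _ 0).obj N) ((singleFunctor _ 0).obj M) ↔
    Function.Bijective (fun f : N ⟶ M => (Dphi φ).map ((singleFunctor _ 0).map f)) :=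
    (Function.Bijective.of_comp_iff _ (hs _ N M)).symm
  rw [h1, this]
  have h2 : Function.Bijective (fun f : N ⟶ M => b ((singleFunctor _ 0).map (F.map f))) ↔
    Function.Bijective (fun f : N ⟶ M => ((singleFunctor _ 0).map (F.map f))) :=
    Function.Bijective.of_comp_iff' b.bijective _
  rw [h2]
  exact (Function.Bijective.of_comp_iff' (hs _ (F.obj N) (F.obj M)) _).symm

lemma subsingleton_ext_of_iso {C : Type*} [Category C] [Abelian C] {_ : HasExt.{w} C} {X Y Y' : C}
    (e : Y ≅ Y') (n : ℕ) [h : Subsingleton (Abelian.Ext.{w} X Y n)] :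
    Subsingleton (Abelian.Ext.{w} X Y' n) := by
  constructor
  intro a b
  have := h.elim (a.comp (Abelian.Ext.mk₀ e.inv) (add_zero n)) (b.comp (Abelian.Ext.mk₀ e.inv) (add_zero n))
  have := congrArg (fun z => z.comp (Abelian.Ext.mk₀ e.hom) (add_zero n)) this
  simpa using this

lemma homology_iso (K : CochainComplex (ModuleCat.{u} S) ℤ) (n : ℤ) :
    Nonempty ((ModuleCat.restrictScalars.{u} φ).obj (K.homology n) ≅
      (((ModuleCat.restrictScalars.{u} φ).mapHomologicalComplex (ComplexShape.up ℤ)).obj K).homology n) :=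
  ⟨((K.sc n).mapHomologyIso (ModuleCat.restrictScalars.{u} φ)).symm⟩

lemma Dphi_hom_eq_zero_of_isLE
    (h : ∀ M : ModuleCat.{u} S, ∀ i : ℕ, 1 ≤ i →
        Subsingleton (Abelian.Ext.{w} (SasR φ) ((ModuleCat.restrictScalars φ).obj M) i))
    (Y : DerivedCategory (ModuleCat.{u} S)) [Y.IsLE (-1)]
    (f : (Dphi φ).obj ((singleFunctor _ 0).obj (ModuleCat.of S S)) ⟶ (Dphi φ).obj Y) : f = 0 := by
  obtain ⟨K, hK, ⟨e⟩⟩ := Y.exists_iso_Q_obj_of_isLE (-1)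
  let F := ModuleCat.restrictScalars.{u} φ
  let e' : (Dphi φ).obj Y ≅ Q.obj ((F.mapHomologicalComplex (ComplexShape.up ℤ)).obj K) :=
    (Dphi φ).mapIso e ≪≫ F.mapDerivedCategoryFactors.app K
  have hh : ∀ n ≤ (-1 : ℤ), Subsingleton (Abelian.Ext.{w} (SasR φ)
      (((F.mapHomologicalComplex (ComplexShape.up ℤ)).obj K).homology n) (-n).toNat) :=
    fun n hn => subsingleton_ext_of_iso (h := h (K.homology n) (-n).toNat (by omega))
      (homology_iso φ K n).some _
  have := hom_single_eq_zero (SasR φ) ((F.mapHomologicalComplex (ComplexShape.up ℤ)).obj K) hh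
    ((singleObjIso φ _).inv ≫ f ≫ e'.hom)
  rw [← cancel_mono e'.hom, ← cancel_epi (singleObjIso φ _).inv, this]
  simp

lemma hom_eq_zero_of_isLE
    (Y : DerivedCategory (ModuleCat.{u} S)) [Y.IsLE (-1)]
    (f : (singleFunctor _ 0).obj (ModuleCat.of S S) ⟶ Y) : f = 0 := by
  obtain ⟨K, hK, ⟨e⟩⟩ := Y.exists_iso_Q_obj_of_isLE (-1)
  have hp : Projective (ModuleCat.of S S) :=
    inferInstance
  have := hom_single_eq_zero (ModuleCat.of S S) K
    (fun n hn => by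
      obtain ⟨m, hm⟩ : ∃ m : ℕ, (-n).toNat = m + 1 := ⟨(-n).toNat - 1, by omega⟩
      rw [hm]
      exact Abelian.Ext.subsingleton_of_projective _ _ _)
    (f ≫ e.hom)
  rw [← cancel_mono e.hom, this, zero_comp]

lemma Dphi_isGE (Y : DerivedCategory (ModuleCat.{u} S)) (n : ℤ) [Y.IsGE n] :
    ((Dphi φ).obj Y).IsGE n := by
  obtain ⟨K, hK, ⟨e⟩⟩ := Y.exists_iso_Q_obj_of_isGE n
  let F := ModuleCat.restrictScalars.{u} φ
  let e' : (Dphi φ).obj Y ≅ Q.obj ((F.mapHomologicalComplex (ComplexShape.up ℤ)).obj K) :=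
    (Dphi φ).mapIso e ≪≫ F.mapDerivedCategoryFactors.app K
  have : CochainComplex.IsStrictlyGE ((F.mapHomologicalComplex (ComplexShape.up ℤ)).obj K) n :=
    inferInstance
  exact TStructure.t.isGE_of_iso e'.symm n

lemma Dphi_hom_eq_zero_of_isGE
    (Y : DerivedCategory (ModuleCat.{u} S)) [Y.IsGE 1]
    (f : (Dphi φ).obj ((singleFunctor _ 0).obj (ModuleCat.of S S)) ⟶ (Dphi φ).obj Y) : f = 0 := by
  have := Dphi_isGE φ Y 1
  rw [← cancel_epi (singleObjIso φ _).inv, comp_zero]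
  exact TStructure.t.zero _ 0 1

lemma hom_eq_zero_of_isGE
    (Y : DerivedCategory (ModuleCat.{u} S)) [Y.IsGE 1]
    (f : (singleFunctor _ 0).obj (ModuleCat.of S S) ⟶ Y) : f = 0 :=
  TStructure.t.zero _ 0 1

lemma FFAt_of_zero {C D : Type*} [Category C] [Category D] [Preadditive C] [Preadditive D]
    {F : C ⥤ D} {X Y : C} (h1 : ∀ f : X ⟶ Y, f = 0) (h2 : ∀ f : F.obj X ⟶ F.obj Y, f = 0) :
    FFAt F X Y :=
  ⟨fun f g _ => (h1 f).trans (h1 g).symm, fun f => ⟨0, (h2 _).trans (h2 _).symm⟩⟩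

lemma FFFrom_S
    (h : ∀ M : ModuleCat.{u} S, Function.Bijective (etaMap φ M) ∧
      ∀ i : ℕ, 1 ≤ i →
        Subsingleton (Abelian.Ext.{w} (SasR φ) ((ModuleCat.restrictScalars φ).obj M) i)) :
    FFFrom (Dphi φ) ((singleFunctor _ 0).obj (ModuleCat.of S S)) := by
  have hLE : ∀ (Y : DerivedCategory (ModuleCat.{u} S)) [Y.IsLE (-1)],
      FFAt (Dphi φ) ((singleFunctor _ 0).obj (ModuleCat.of S S)) Y := fun Y _ =>
    FFAt_of_zero (hom_eq_zero_of_isLE Y) (Dphi_hom_eq_zero_of_isLE φ (fun M => (h M).2) Y)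
  have hGE : ∀ (Y : DerivedCategory (ModuleCat.{u} S)) [Y.IsGE 1],
      FFAt (Dphi φ) ((singleFunctor _ 0).obj (ModuleCat.of S S)) Y := fun Y _ =>
    FFAt_of_zero (hom_eq_zero_of_isGE Y) (Dphi_hom_eq_zero_of_isGE φ Y)
  have h0 : ∀ (Y : DerivedCategory (ModuleCat.{u} S)) [Y.IsGE 0] [Y.IsLE 0],
      FFAt (Dphi φ) ((singleFunctor _ 0).obj (ModuleCat.of S S)) Y := fun Y _ _ => by
    obtain ⟨M, ⟨e⟩⟩ := exists_iso_singleFunctor_obj_of_isGE_of_isLE Y 0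
    exact ((single_bij_iff φ _ _).1 ((F_bij_iff φ M).1 (h M).1)).of_iso (Iso.refl _) e.symm
  have hGE0 : ∀ (Y : DerivedCategory (ModuleCat.{u} S)) [Y.IsGE 0],
      FFAt (Dphi φ) ((singleFunctor _ 0).obj (ModuleCat.of S S)) Y := fun Y _ => by
    have hT := TStructure.t.triangleLEGT_distinguished 0 Y
    have h1 : ((TStructure.t.truncGT 0).obj Y).IsGE 1 := TStructure.t.isGE_truncGT_obj Y 0 1
    have h2 : ((TStructure.t.truncLE 0).obj Y).IsLE 0 := inferInstance
    have h3 : ((TStructure.t.truncLE 0).obj Y).IsGE 0 := inferInstance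
    refine FFAt.of_triangle (Dphi φ) hT (h0 ((TStructure.t.truncLE 0).obj Y))
      (hGE ((TStructure.t.truncGT 0).obj Y)) ?_ ?_
    · intro f _
      have : (((TStructure.t.truncLE 0).obj Y)⟦(1 : ℤ)⟧).IsLE (-1) :=
        TStructure.t.isLE_shift _ 0 1 (-1)
      exact hom_eq_zero_of_isLE (((TStructure.t.truncLE 0).obj Y)⟦(1 : ℤ)⟧) f
    · have : (((TStructure.t.truncGT 0).obj Y)⟦(-1 : ℤ)⟧).IsGE 2 :=
        TStructure.t.isGE_shift _ 1 (-1) 2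
      have : (((TStructure.t.truncGT 0).obj Y)⟦(-1 : ℤ)⟧).IsGE 1 :=
        TStructure.t.isGE_of_ge _ 1 2
      exact (hGE (((TStructure.t.truncGT 0).obj Y)⟦(-1 : ℤ)⟧)).2
  intro Y
  have hT := TStructure.t.triangleLEGT_distinguished (-1) Y
  have h1 : ((TStructure.t.truncGT (-1)).obj Y).IsGE 0 := TStructure.t.isGE_truncGT_obj Y (-1) 0
  have h2 : ((TStructure.t.truncLE (-1)).obj Y).IsLE (-1) := inferInstance
  refine FFAt.of_triangle (Dphi φ) hT (hLE ((TStructure.t.truncLE (-1)).obj Y))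
    (hGE0 ((TStructure.t.truncGT (-1)).obj Y)) ?_ ?_
  · intro f _
    have : (((TStructure.t.truncLE (-1)).obj Y)⟦(1 : ℤ)⟧).IsLE (-2) :=
      TStructure.t.isLE_shift _ (-1) 1 (-2)
    have : (((TStructure.t.truncLE (-1)).obj Y)⟦(1 : ℤ)⟧).IsLE (-1) :=
      TStructure.t.isLE_of_le _ (-2) (-1)
    exact hom_eq_zero_of_isLE (((TStructure.t.truncLE (-1)).obj Y)⟦(1 : ℤ)⟧) f
  · have : (((TStructure.t.truncGT (-1)).obj Y)⟦(-1 : ℤ)⟧).IsGE 1 :=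
      TStructure.t.isGE_shift _ 0 (-1) 1
    exact (hGE (((TStructure.t.truncGT (-1)).obj Y)⟦(-1 : ℤ)⟧)).2

lemma restrictScalars_preservesCoproducts (I : Type u) :
    PreservesColimitsOfShape (Discrete I) (Dphi φ) := by
  have : PreservesColimitsOfSize.{u, u} (ModuleCat.restrictScalars.{u} φ) :=
    (ModuleCat.restrictCoextendScalarsAdj.{u} φ).leftAdjoint_preservesColimits
  exact mapDerived_preservesCoproducts (I := I) (ModuleCat.restrictScalars.{u} φ)

lemma isLoc_FFFrom
    (h : FFFrom (Dphi φ) ((singleFunctor _ 0).obj (ModuleCat.of S S))) :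
    IsLoc (FFFrom (Dphi φ)) where
  iso e hX := hX.of_iso e
  cone hT h1 h2 := FFFrom.cone hT h1 h2
  coprod {I} X hX := by
    have := restrictScalars_preservesCoproducts φ I
    exact FFFrom.coprod (F := Dphi φ) (coproductIsCoproduct X) (fun i => hX i.as)
  gen n := (h.shift (-n)).of_iso
    (((singleFunctors (ModuleCat.{u} S)).shiftIso (-n) n 0 (by simp)).app (ModuleCat.of S S))

lemma ext_vanishing [(Dphi φ).Full] (M : ModuleCat.{u} S) (i : ℕ) (hi : 1 ≤ i) :
    Subsingleton (Abelian.Ext.{w} (SasR φ) ((ModuleCat.restrictScalars φ).obj M) i) := by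
  suffices ∀ e : Abelian.Ext.{w} (SasR φ) ((ModuleCat.restrictScalars φ).obj M) i, e = 0 from
    ⟨fun a b => (this a).trans (this b).symm⟩
  intro e
  let c : (Dphi φ).obj (((singleFunctor _ 0).obj M)⟦(i : ℤ)⟧) ≅
    ((singleFunctor _ 0).obj ((ModuleCat.restrictScalars φ).obj M))⟦(i : ℤ)⟧ :=
    ((Dphi φ).commShiftIso (i : ℤ)).app _ ≪≫ (shiftFunctor _ (i : ℤ)).mapIso (singleObjIso φ M)
  obtain ⟨g, hg⟩ := (Dphi φ).map_surjective ((singleObjIso φ (ModuleCat.of S S)).hom ≫ e.hom ≫ c.inv)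
  have h1 : (((singleFunctor (ModuleCat.{u} S) 0).obj M)⟦(i : ℤ)⟧).IsLE (-i) :=
    TStructure.t.isLE_shift _ 0 i (-i)
  have h2 : (((singleFunctor (ModuleCat.{u} S) 0).obj M)⟦(i : ℤ)⟧).IsLE (-1) :=
    TStructure.t.isLE_of_le _ (-i) (-1)
  have hg0 := hom_eq_zero_of_isLE _ g
  rw [hg0, Functor.map_zero] at hg
  have h3 : e.hom = 0 := by
    rw [← cancel_mono c.inv, ← cancel_epi (singleObjIso φ (ModuleCat.of S S)).hom]
    exact hg.symm.trans (by simp)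
  ext
  rw [h3]
  simp

/-- For a ring homomorphism `φ : R →+* S`, the functor `D(φ) : D(S) → D(R)` induced by
restriction of scalars is fully faithful if and only if for every left `S`-module `M`
the canonical map `η_M : M → Hom_R(S,M)`, `m ↦ (s ↦ s • m)`, is bijective and
`Ext^i_R(S,M) = 0` for all `i ≥ 1`. -/
theorem derived_fully_faithful_iff_eta_bijective_and_ext_vanishing :
    ((Dphi φ).Full ∧ (Dphi φ).Faithful) ↔
    (∀ M : ModuleCat.{u} S, Function.Bijective (etaMap φ M) ∧
      ∀ i : ℕ, 1 ≤ i →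
        Subsingleton (Abelian.Ext.{w} (SasR φ) ((ModuleCat.restrictScalars φ).obj M) i)) := by
  constructor
  · rintro ⟨_, _⟩ M
    refine ⟨?_, fun i hi => ext_vanishing φ M i hi⟩
    rw [F_bij_iff, single_bij_iff]
    exact ⟨(Dphi φ).map_injective, (Dphi φ).map_surjective⟩
  · intro h
    have hall := (isLoc_FFFrom φ (FFFrom_S φ h)).all
    exact ⟨⟨fun {X Y} f => (hall X Y).2 f⟩, ⟨fun {X Y} f g hfg => (hall X Y).1 hfg⟩⟩

end RingHomEpi
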